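/- Let θ₁ < θ₂ with θ₁, θ₂ ∈ E and (θ₁,θ₂) ∩ E = ∅. If λ₁, λ₂ ∈ ℝ, f₁ ∈ S_st^{λ₁}, f₂ ∈ S_st^{λ₂}, 𝔼[f₁(0,·)] = θ₁ and 𝔼[f₂(0,·)] = θ₂, then λ₁ = λ₂. (In other words, the value λ(θ) agrees at the two endpoints of any connected component of E^c.) -/

import Mathlib

open MeasureTheory Filter Set

structure HJSetting {Ω : Type} [MeasurableSpace Ω] (P : Measure Ω) (τ : ℝ → Ω → Ω)
    (a : ℝ → Ω → ℝ) (H : ℝ → ℝ → Ω → ℝ) (G_L G_U : ℝ → ℝ) : Prop where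
  prob : IsProbabilityMeasure P
  meas_tau : Measurable fun q : ℝ × Ω => τ q.1 q.2
  mp_tau : ∀ x, MeasurePreserving (τ x) P P
  tau_zero : ∀ ω, τ 0 ω = ω
  tau_add : ∀ x y ω, τ (x + y) ω = τ x (τ y ω)
  ergodic : ∀ A : Set Ω, MeasurableSet A → (∀ x, τ x ⁻¹' A = A) → P A = 0 ∨ P A = 1
  meas_a : Measurable fun q : ℝ × Ω => a q.1 q.2
  a_pos : ∀ x ω, 0 < a x ω
  a_le_one : ∀ x ω, a x ω ≤ 1
  a_stat : ∀ x ω, a x ω = a 0 (τ x ω)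
  a_sqrt_lip : ∃ κ > (0:ℝ), ∀ x ω, |Real.sqrt (a x ω) - Real.sqrt (a 0 ω)| ≤ κ * |x|
  meas_H : Measurable fun q : ℝ × ℝ × Ω => H q.1 q.2.1 q.2.2
  H_stat : ∀ p x ω, H p x ω = H p 0 (τ x ω)
  GL_cont : Continuous G_L
  GU_cont : Continuous G_U
  GL_even : ∀ p, G_L (-p) = G_L p
  GU_even : ∀ p, G_U (-p) = G_U p
  GL_mono : MonotoneOn G_L (Ici 0)
  GU_mono : MonotoneOn G_U (Ici 0)
  GL_coercive : Tendsto G_L atTop atTop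
  GU_coercive : Tendsto G_U atTop atTop
  H_lower : ∀ p ω, G_L p ≤ H p 0 ω
  H_upper : ∀ p ω, H p 0 ω ≤ G_U p
  H_lip : ∀ R > (0:ℝ), ∃ K > (0:ℝ), ∀ p q ω, |p| ≤ R → |q| ≤ R →
      |H p 0 ω - H q 0 ω| ≤ K * |p - q|
  H_mod : ∀ R > (0:ℝ), ∃ m : ℝ → ℝ, (∀ r, 0 ≤ m r) ∧ MonotoneOn m (Ici 0) ∧
      Tendsto m (nhdsWithin 0 (Ioi 0)) (nhds 0) ∧
      ∀ p x ω, |p| ≤ R → |H p x ω - H p 0 ω| ≤ m |x|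

/-- `f` is a stationary solution of `a(x,ω) f' + H(f,x,ω) = lam`. -/
def StatSol {Ω : Type} [MeasurableSpace Ω] (P : Measure Ω) (τ : ℝ → Ω → Ω)
    (a : ℝ → Ω → ℝ) (H : ℝ → ℝ → Ω → ℝ) (lam : ℝ) (f : ℝ → Ω → ℝ) : Prop :=
  (Measurable fun q : ℝ × Ω => f q.1 q.2) ∧
  (∀ x ω, f x ω = f 0 (τ x ω)) ∧
  (∀ ω, ContDiff ℝ 1 fun x => f x ω) ∧
  (∀ᵐ ω ∂P, (∃ M, ∀ x, |f x ω| ≤ M) ∧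
    ∀ x, a x ω * deriv (fun y => f y ω) x + H (f x ω) x ω = lam)

/-- The set `E` of expectations `𝔼[f(0,·)]` over all stationary solutions `f`. -/
def Eset {Ω : Type} [MeasurableSpace Ω] (P : Measure Ω) (τ : ℝ → Ω → Ω)
    (a : ℝ → Ω → ℝ) (H : ℝ → ℝ → Ω → ℝ) : Set ℝ :=
  {θ | ∃ lam f, StatSol P τ a H lam f ∧ (∫ ω, f 0 ω ∂P) = θ}

/-- The exponential integrating factor `exp (K ∫₀ʸ 1/α)`. -/
noncomputable def expWeight (α : ℝ → ℝ) (K y : ℝ) : ℝ :=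
  Real.exp (K * ∫ s in (0 : ℝ)..y, (α s)⁻¹)

/-- The bounded solution `u` of `α u' + K u = h` on the whole line. -/
noncomputable def relax (α : ℝ → ℝ) (K : ℝ) (h : ℝ → ℝ) (x : ℝ) : ℝ :=
  (expWeight α K x)⁻¹ * ∫ y in Iic x, expWeight α K y * (α y)⁻¹ * h y

section Deterministic

variable {α : ℝ → ℝ} {K : ℝ}

lemma expWeight_pos (y : ℝ) : 0 < expWeight α K y := Real.exp_pos _

lemma hasDerivAt_expWeight (hα : Continuous α) (hpos : ∀ x, 0 < α x) (y : ℝ) :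
    HasDerivAt (expWeight α K) (K * (expWeight α K y * (α y)⁻¹)) y := by
  have hc : Continuous fun s => (α s)⁻¹ := hα.inv₀ fun x => (hpos x).ne'
  have h := ((hc.integral_hasStrictDerivAt 0 y).hasDerivAt.const_mul K).exp
  unfold expWeight
  convert h using 1
  ring

lemma continuous_expWeight (hα : Continuous α) (hpos : ∀ x, 0 < α x) :
    Continuous (expWeight α K) :=
  continuous_iff_continuousAt.2 fun y => (hasDerivAt_expWeight hα hpos y).continuousAt

lemma continuous_expWeight_mul_inv (hα : Continuous α) (hpos : ∀ x, 0 < α x) :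
    Continuous fun y => expWeight α K y * (α y)⁻¹ :=
  (continuous_expWeight hα hpos).mul (hα.inv₀ fun x => (hpos x).ne')

lemma expWeight_mul_inv_nonneg (hpos : ∀ x, 0 < α x) (y : ℝ) :
    0 ≤ expWeight α K y * (α y)⁻¹ :=
  mul_nonneg (expWeight_pos y).le (inv_nonneg.2 (hpos y).le)

lemma tendsto_expWeight_atBot (hα : Continuous α) (hpos : ∀ x, 0 < α x) (hle : ∀ x, α x ≤ 1)
    (hK : 0 < K) : Tendsto (expWeight α K) atBot (nhds 0) := by
  have hc : Continuous fun s => (α s)⁻¹ := hα.inv₀ fun x => (hpos x).ne'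
  have hlin : Tendsto (fun y : ℝ => Real.exp (K * y)) atBot (nhds 0) :=
    Real.tendsto_exp_atBot.comp (tendsto_id.const_mul_atBot hK)
  refine tendsto_of_tendsto_of_tendsto_of_le_of_le' tendsto_const_nhds hlin
    (Eventually.of_forall fun y => (expWeight_pos y).le) ?_
  filter_upwards [eventually_le_atBot (0 : ℝ)] with y hy
  refine Real.exp_le_exp.2 (mul_le_mul_of_nonneg_left ?_ hK.le)
  have h := intervalIntegral.integral_mono_on (μ := volume) hy
    (continuous_const (y := (1 : ℝ))).continuousOn.intervalIntegrable
    hc.continuousOn.intervalIntegrable fun x _ => (one_le_inv₀ (hpos x)).2 (hle x)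
  rw [intervalIntegral.integral_symm]
  simp at h
  linarith

lemma integrableOn_expWeight_mul_inv (hα : Continuous α) (hpos : ∀ x, 0 < α x) (hK : 0 < K)
    (x : ℝ) : IntegrableOn (fun y => expWeight α K y * (α y)⁻¹) (Iic x) := by
  have hc := continuous_expWeight_mul_inv (K := K) hα hpos
  refine integrableOn_Iic_of_intervalIntegral_norm_bounded (l := atBot) (a := id)
    (expWeight α K x / K) x (fun i => (hc.integrableOn_Ioc)) tendsto_id ?_
  refine Eventually.of_forall fun i => ?_
  have hint : ∫ y in i..x, expWeight α K y * (α y)⁻¹ =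
      expWeight α K x / K - expWeight α K i / K := by
    refine intervalIntegral.integral_eq_sub_of_hasDerivAt (f := fun y => expWeight α K y / K)
      (fun y _ => ?_) hc.continuousOn.intervalIntegrable
    exact ((hasDerivAt_expWeight (K := K) hα hpos y).div_const K).congr_deriv
      (mul_div_cancel_left₀ _ hK.ne')
  have hnorm : ∀ y, ‖expWeight α K y * (α y)⁻¹‖ = expWeight α K y * (α y)⁻¹ := fun y =>
    Real.norm_of_nonneg (expWeight_mul_inv_nonneg hpos y)
  simp only [hnorm, id, hint]
  have := div_pos (expWeight_pos (α := α) (K := K) i) hK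
  linarith

lemma integrableOn_expWeight_mul (hα : Continuous α) (hpos : ∀ x, 0 < α x) (hK : 0 < K)
    {h : ℝ → ℝ} (hm : Measurable h) {C : ℝ} (hC : ∀ y, |h y| ≤ C) (x : ℝ) :
    IntegrableOn (fun y => expWeight α K y * (α y)⁻¹ * h y) (Iic x) :=
  (integrableOn_expWeight_mul_inv hα hpos hK x).mul_bdd (c := C) hm.aestronglyMeasurable
    (Eventually.of_forall hC)

lemma relax_eq_of_hasDerivAt (hα : Continuous α) (hpos : ∀ x, 0 < α x) (hle : ∀ x, α x ≤ 1)
    (hK : 0 < K) {u u' h : ℝ → ℝ} (hu : ∀ x, HasDerivAt u (u' x) x)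
    (huh : ∀ x, α x * u' x + K * u x = h x) (hm : Measurable h) {M C : ℝ}
    (hM : ∀ x, |u x| ≤ M) (hC : ∀ x, |h x| ≤ C) (x : ℝ) : relax α K h x = u x := by
  have hlim : Tendsto (fun y => expWeight α K y * u y) atBot (nhds 0) := by
    refine squeeze_zero_norm (a := fun y => expWeight α K y * M) (fun y => ?_) ?_
    · rw [norm_mul, Real.norm_of_nonneg (expWeight_pos y).le]
      exact mul_le_mul_of_nonneg_left (hM y) (expWeight_pos y).le
    · simpa using (tendsto_expWeight_atBot hα hpos hle hK).mul_const M
  have hint := integral_Iic_of_hasDerivAt_of_tendsto' (a := x)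
    (f' := fun y => expWeight α K y * (α y)⁻¹ * h y) (fun y _ => ?_)
    (integrableOn_expWeight_mul hα hpos hK hm hC x) hlim
  · rw [relax, hint, sub_zero, inv_mul_cancel_left₀ (expWeight_pos x).ne']
  · refine ((hasDerivAt_expWeight (K := K) hα hpos y).mul (hu y)).congr_deriv ?_
    rw [← huh y]
    have := (hpos y).ne'
    field_simp
    ring

lemma relax_const (hα : Continuous α) (hpos : ∀ x, 0 < α x) (hle : ∀ x, α x ≤ 1)
    (hK : 0 < K) (c x : ℝ) : relax α K (fun _ => c) x = c / K :=
  relax_eq_of_hasDerivAt hα hpos hle hK (u := fun _ => c / K) (u' := fun _ => 0)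
    (fun x => hasDerivAt_const x _) (fun x => by field_simp; ring) measurable_const
    (M := |c / K|) (C := |c|) (fun _ => le_rfl) (fun _ => le_rfl) x

lemma relax_add (hα : Continuous α) (hpos : ∀ x, 0 < α x) (hK : 0 < K)
    {g h : ℝ → ℝ} (hgm : Measurable g) (hhm : Measurable h) {C D : ℝ} (hC : ∀ y, |g y| ≤ C)
    (hD : ∀ y, |h y| ≤ D) (x : ℝ) :
    relax α K (fun y => g y + h y) x = relax α K g x + relax α K h x := by
  simp only [relax, mul_add]
  rw [integral_add (integrableOn_expWeight_mul hα hpos hK hgm hC x)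
    (integrableOn_expWeight_mul hα hpos hK hhm hD x), mul_add]

lemma relax_mono (hα : Continuous α) (hpos : ∀ x, 0 < α x) (hK : 0 < K)
    {g h : ℝ → ℝ} (hgm : Measurable g) (hhm : Measurable h) {C D : ℝ} (hC : ∀ y, |g y| ≤ C)
    (hD : ∀ y, |h y| ≤ D) (hgh : ∀ y, g y ≤ h y) (x : ℝ) : relax α K g x ≤ relax α K h x :=
  mul_le_mul_of_nonneg_left
    (integral_mono (integrableOn_expWeight_mul hα hpos hK hgm hC x)
      (integrableOn_expWeight_mul hα hpos hK hhm hD x)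
      fun y => mul_le_mul_of_nonneg_left (hgh y) (expWeight_mul_inv_nonneg hpos y))
    (inv_nonneg.2 (expWeight_pos x).le)

lemma tendsto_relax (hα : Continuous α) (hpos : ∀ x, 0 < α x) (hK : 0 < K)
    {h : ℕ → ℝ → ℝ} {g : ℝ → ℝ} (hm : ∀ n, Measurable (h n)) {C : ℝ} (hC : ∀ n y, |h n y| ≤ C)
    (hlim : ∀ y, Tendsto (fun n => h n y) atTop (nhds (g y))) (x : ℝ) :
    Tendsto (fun n => relax α K (h n) x) atTop (nhds (relax α K g x)) := by
  refine Tendsto.const_mul _ (tendsto_integral_of_dominated_convergence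
    (fun y => expWeight α K y * (α y)⁻¹ * C) (fun n => ?_) ?_ (fun n => ?_) ?_)
  · exact ((continuous_expWeight_mul_inv hα hpos).measurable.mul (hm n)).aestronglyMeasurable
  · exact (integrableOn_expWeight_mul_inv hα hpos hK x).mul_const C
  · refine Eventually.of_forall fun y => ?_
    rw [norm_mul, Real.norm_of_nonneg (expWeight_mul_inv_nonneg hpos y)]
    exact mul_le_mul_of_nonneg_left (hC n y) (expWeight_mul_inv_nonneg hpos y)
  · exact Eventually.of_forall fun y => (hlim y).const_mul _

lemma integral_Iic_expWeight (hα : Continuous α) (hpos : ∀ x, 0 < α x) (hK : 0 < K)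
    {h : ℝ → ℝ} (hm : Measurable h) {C : ℝ} (hC : ∀ y, |h y| ≤ C) (x : ℝ) :
    ∫ y in Iic x, expWeight α K y * (α y)⁻¹ * h y =
      (∫ y in Iic (0 : ℝ), expWeight α K y * (α y)⁻¹ * h y) +
        ∫ y in (0 : ℝ)..x, expWeight α K y * (α y)⁻¹ * h y := by
  rw [← intervalIntegral.integral_Iic_sub_Iic (integrableOn_expWeight_mul hα hpos hK hm hC 0)
    (integrableOn_expWeight_mul hα hpos hK hm hC x)]
  ring

lemma continuous_relax (hα : Continuous α) (hpos : ∀ x, 0 < α x) (hK : 0 < K)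
    {h : ℝ → ℝ} (hm : Measurable h) {C : ℝ} (hC : ∀ y, |h y| ≤ C) :
    Continuous (relax α K h) := by
  have hprim : Continuous fun x => ∫ y in (0 : ℝ)..x, expWeight α K y * (α y)⁻¹ * h y :=
    intervalIntegral.continuous_primitive (fun a b =>
      ⟨(integrableOn_expWeight_mul hα hpos hK hm hC b).mono_set Ioc_subset_Iic_self,
        (integrableOn_expWeight_mul hα hpos hK hm hC a).mono_set Ioc_subset_Iic_self⟩) 0
  refine ((continuous_expWeight hα hpos).inv₀ fun x => (expWeight_pos x).ne').mul ?_
  rw [funext (integral_Iic_expWeight hα hpos hK hm hC)]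
  exact continuous_const.add hprim

lemma hasDerivAt_relax (hα : Continuous α) (hpos : ∀ x, 0 < α x) (hK : 0 < K)
    {h : ℝ → ℝ} (hc : Continuous h) {C : ℝ} (hC : ∀ y, |h y| ≤ C) (x : ℝ) :
    HasDerivAt (relax α K h) ((α x)⁻¹ * (h x - K * relax α K h x)) x := by
  have hE := expWeight_pos (α := α) (K := K) x
  have hI : HasDerivAt (fun x => ∫ y in Iic x, expWeight α K y * (α y)⁻¹ * h y)
      (expWeight α K x * (α x)⁻¹ * h x) x := by
    rw [funext (integral_Iic_expWeight hα hpos hK hc.measurable hC)]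
    exact (((continuous_expWeight_mul_inv hα hpos).mul hc).integral_hasStrictDerivAt
      0 x).hasDerivAt.const_add _
  refine (((hasDerivAt_expWeight (K := K) hα hpos x).inv hE.ne').mul hI).congr_deriv ?_
  have := (hpos x).ne'
  simp only [relax, Pi.inv_apply]
  field_simp
  ring

lemma expWeight_shift (hα : Continuous α) (hpos : ∀ x, 0 < α x) (x y : ℝ) :
    expWeight (fun s => α (s + x)) K y = (expWeight α K x)⁻¹ * expWeight α K (y + x) := by
  have hc : Continuous fun s => (α s)⁻¹ := hα.inv₀ fun x => (hpos x).ne'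
  simp only [expWeight]
  rw [intervalIntegral.integral_comp_add_right fun s => (α s)⁻¹, ← Real.exp_neg, ← Real.exp_add,
    zero_add, ← intervalIntegral.integral_interval_sub_left (a := 0)
      (hc.intervalIntegrable _ _) (hc.intervalIntegrable _ _)]
  congr 1
  ring

lemma relax_shift (hα : Continuous α) (hpos : ∀ x, 0 < α x) (h : ℝ → ℝ) (x : ℝ) :
    relax (fun s => α (s + x)) K (fun s => h (s + x)) 0 = relax α K h x := by
  have hE := expWeight_pos (α := α) (K := K) x
  have hset := (measurePreserving_add_right volume x).setIntegral_preimage_emb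
    (measurableEmbedding_addRight x) (fun y => expWeight α K y * (α y)⁻¹ * h y) (Iic x)
  have hpre : (fun y => y + x) ⁻¹' Iic x = Iic 0 := by
    ext y; simp
  rw [hpre] at hset
  simp only [relax, expWeight_shift hα hpos, zero_add, inv_mul_cancel₀ hE.ne', inv_one, one_mul,
    mul_assoc, integral_const_mul]
  simp only [mul_assoc] at hset
  rw [hset]

end Deterministic

section MonotoneScheme

variable {α : ℝ → ℝ} {K lam R C : ℝ} {h : ℝ → ℝ → ℝ}

lemma source_mono
    (hlip : ∀ p q y, |p| ≤ R → |q| ≤ R → |h p y - h q y| ≤ K * |p - q|) {p q : ℝ}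
    (hp : |p| ≤ R) (hq : |q| ≤ R) (hpq : p ≤ q) (y : ℝ) :
    lam + K * p - h p y ≤ lam + K * q - h q y := by
  have h1 := (abs_le.1 (hlip q p y hq hp)).2
  rw [abs_of_nonneg (sub_nonneg.2 hpq)] at h1
  linarith

lemma source_bound (hK : 0 < K) (hbd : ∀ p y, |p| ≤ R → |h p y| ≤ C) {p : ℝ} (hp : |p| ≤ R)
    (y : ℝ) : |lam + K * p - h p y| ≤ |lam| + K * R + C := by
  have h1 : |K * p| ≤ K * R := by
    rw [abs_mul, abs_of_pos hK]
    exact mul_le_mul_of_nonneg_left hp hK.le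
  calc |lam + K * p - h p y| ≤ |lam + K * p| + |h p y| := abs_sub _ _
    _ ≤ |lam| + |K * p| + |h p y| := by gcongr; exact abs_add_le _ _
    _ ≤ _ := add_le_add (by gcongr) (hbd p y hp)

lemma measurable_source (hmeas : Measurable fun q : ℝ × ℝ => h q.1 q.2) {u : ℝ → ℝ}
    (hu : Measurable u) : Measurable fun y => lam + K * u y - h (u y) y :=
  ((hu.const_mul K).const_add lam).sub (hmeas.comp (hu.prodMk measurable_id))

lemma relax_source_of_solution (hα : Continuous α) (hpos : ∀ x, 0 < α x) (hle : ∀ x, α x ≤ 1)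
    (hK : 0 < K) (hmeas : Measurable fun q : ℝ × ℝ => h q.1 q.2)
    (hbd : ∀ p y, |p| ≤ R → |h p y| ≤ C) {v : ℝ → ℝ} {mu : ℝ} (hv : Differentiable ℝ v)
    (hode : ∀ x, α x * deriv v x + h (v x) x = mu) (hvR : ∀ x, |v x| ≤ R) (x : ℝ) :
    relax α K (fun y => lam + K * v y - h (v y) y) x = v x + (lam - mu) / K := by
  have hm := measurable_source (lam := mu) (K := K) hmeas hv.continuous.measurable
  have hb := fun y => source_bound (lam := mu) hK hbd (hvR y) y
  have h1 := relax_eq_of_hasDerivAt hα hpos hle hK (fun x => (hv x).hasDerivAt)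
    (h := fun y => mu + K * v y - h (v y) y) (fun x => by rw [← hode x]; ring) hm hvR hb x
  have h2 := relax_add hα hpos hK hm (measurable_const (a := lam - mu)) hb
    (fun _ => le_rfl) x
  rw [h1, relax_const hα hpos hle hK] at h2
  rw [← h2]
  congr 1
  ext y
  ring

/-- Iterating `relax` from a strict supersolution lying above a strict subsolution produces a
solution strictly between the two. -/
lemma solution_of_iterate (hα : Continuous α) (hpos : ∀ x, 0 < α x) (hle : ∀ x, α x ≤ 1)
    (hK : 0 < K) (hmeas : Measurable fun q : ℝ × ℝ => h q.1 q.2)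
    (hlip : ∀ p q y, |p| ≤ R → |q| ≤ R → |h p y - h q y| ≤ K * |p - q|)
    (hbd : ∀ p y, |p| ≤ R → |h p y| ≤ C)
    (hcont : ∀ w : ℝ → ℝ, Continuous w → (∀ x, |w x| ≤ R) → Continuous fun x => h (w x) x)
    {v₁ v₂ : ℝ → ℝ} {lam₁ lam₂ : ℝ} (hv₁ : Differentiable ℝ v₁) (hv₂ : Differentiable ℝ v₂)
    (hode₁ : ∀ x, α x * deriv v₁ x + h (v₁ x) x = lam₁)
    (hode₂ : ∀ x, α x * deriv v₂ x + h (v₂ x) x = lam₂)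
    (hR₁ : ∀ x, |v₁ x| ≤ R) (hR₂ : ∀ x, |v₂ x| ≤ R) (hv : ∀ x, v₁ x ≤ v₂ x)
    (hlam₁ : lam₁ ≤ lam) (hlam₂ : lam ≤ lam₂)
    {u : ℕ → ℝ → ℝ} (hum : ∀ k, Measurable (u k)) (hu0 : ∀ x, u 0 x = v₂ x)
    (hus : ∀ k x, u (k + 1) x = relax α K (fun y => lam + K * u k y - h (u k y) y) x) :
    ContDiff ℝ 1 (fun x => ⨅ k, u k x) ∧
      (∀ x, α x * deriv (fun x => ⨅ k, u k x) x + h (⨅ k, u k x) x = lam) ∧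
      ∀ x, v₁ x + (lam - lam₁) / K ≤ ⨅ k, u k x ∧ ⨅ k, u k x ≤ v₂ x + (lam - lam₂) / K := by
  have hrel₁ := relax_source_of_solution (lam := lam) hα hpos hle hK hmeas hbd hv₁ hode₁ hR₁
  have hrel₂ := relax_source_of_solution (lam := lam) hα hpos hle hK hmeas hbd hv₂ hode₂ hR₂
  have hd₁ : 0 ≤ (lam - lam₁) / K := div_nonneg (sub_nonneg.2 hlam₁) hK.le
  have hd₂ : (lam - lam₂) / K ≤ 0 := div_nonpos_of_nonpos_of_nonneg (sub_nonpos.2 hlam₂) hK.le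
  have hbetween : ∀ {p x}, v₁ x ≤ p → p ≤ v₂ x → |p| ≤ R := fun {p x} h1 h2 =>
    abs_le.2 ⟨(abs_le.1 (hR₁ x)).1.trans h1, h2.trans (abs_le.1 (hR₂ x)).2⟩
  have hrmono : ∀ {f g : ℝ → ℝ}, Measurable f → Measurable g → (∀ x, |f x| ≤ R) →
      (∀ x, |g x| ≤ R) → (∀ x, f x ≤ g x) → ∀ x,
      relax α K (fun y => lam + K * f y - h (f y) y) x ≤
        relax α K (fun y => lam + K * g y - h (g y) y) x := fun {f g} hf hg hfR hgR hfg x =>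
    relax_mono hα hpos hK (measurable_source hmeas hf) (measurable_source hmeas hg)
      (fun y => source_bound hK hbd (hfR y) y) (fun y => source_bound hK hbd (hgR y) y)
      (fun y => source_mono hlip (hfR y) (hgR y) (hfg y) y) x
  have hind : ∀ k x, v₁ x ≤ u k x ∧ u (k + 1) x ≤ u k x ∧ u k x ≤ v₂ x := by
    intro k
    induction k with
    | zero =>
      intro x
      have h0 : u 0 = v₂ := funext hu0
      refine ⟨by rw [h0]; exact hv x, ?_, by rw [h0]⟩
      rw [hus, h0, hrel₂]
      linarith
    | succ k ih =>
      have hkR : ∀ x, |u k x| ≤ R := fun x => hbetween (ih x).1 (ih x).2.2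
      have hlow : ∀ x, v₁ x ≤ u (k + 1) x := fun x => by
        have := hrmono hv₁.continuous.measurable (hum k) hR₁ hkR (fun y => (ih y).1) x
        rw [hrel₁, ← hus] at this
        linarith
      have hup : ∀ x, u (k + 1) x ≤ v₂ x := fun x => (ih x).2.1.trans (ih x).2.2
      intro x
      refine ⟨hlow x, ?_, hup x⟩
      have := hrmono (hum (k + 1)) (hum k) (fun y => hbetween (hlow y) (hup y)) hkR
        (fun y => (ih y).2.1) x
      rwa [← hus, ← hus] at this
  have hbddBelow : ∀ x, BddBelow (range fun k => u k x) := fun x =>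
    ⟨v₁ x, by rintro _ ⟨k, rfl⟩; exact (hind k x).1⟩
  have hlim : ∀ x, Tendsto (fun k => u k x) atTop (nhds (⨅ k, u k x)) := fun x =>
    tendsto_atTop_ciInf (antitone_nat_of_succ_le fun k => (hind k x).2.1) (hbddBelow x)
  have hmeasw : Measurable fun x => ⨅ k, u k x := Measurable.iInf hum
  set w : ℝ → ℝ := fun x => ⨅ k, u k x with hw
  have hw₁ : ∀ x, v₁ x ≤ w x := fun x => le_ciInf fun k => (hind k x).1
  have hw₂ : ∀ x, w x ≤ v₂ x := fun x => (ciInf_le (hbddBelow x) 0).trans (hind 0 x).2.2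
  have hwR : ∀ x, |w x| ≤ R := fun x => hbetween (hw₁ x) (hw₂ x)
  have hkR : ∀ k x, |u k x| ≤ R := fun k x => hbetween (hind k x).1 (hind k x).2.2
  have hfix : ∀ x, w x = relax α K (fun y => lam + K * w y - h (w y) y) x := by
    intro x
    refine tendsto_nhds_unique ((tendsto_add_atTop_iff_nat 1).2 (hlim x)) ?_
    simp only [hus]
    refine tendsto_relax hα hpos hK (fun k => measurable_source hmeas (hum k))
      (fun k y => source_bound hK hbd (hkR k y) y) (fun y => ?_) x
    refine ((hlim y).const_mul K |>.const_add lam).sub ?_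
    refine tendsto_iff_norm_sub_tendsto_zero.2 (squeeze_zero (fun _ => norm_nonneg _)
      (fun k => hlip _ _ y (hkR k y) (hwR y)) ?_)
    simpa using (tendsto_iff_norm_sub_tendsto_zero.1 (hlim y)).const_mul K
  have hwc : Continuous w := by
    rw [funext hfix]
    exact continuous_relax hα hpos hK (measurable_source hmeas hmeasw)
      fun y => source_bound hK hbd (hwR y) y
  have hhc : Continuous fun x => h (w x) x := hcont w hwc hwR
  have hder : ∀ x, HasDerivAt w ((α x)⁻¹ * (lam - h (w x) x)) x := by
    intro x
    have h1 := hasDerivAt_relax hα hpos hK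
      (h := fun y => lam + K * w y - h (w y) y)
      (((continuous_const.mul hwc).const_add lam).sub hhc)
      (fun y => source_bound hK hbd (hwR y) y) x
    rw [← hfix x, ← funext hfix] at h1
    exact h1.congr_deriv (by ring)
  refine ⟨?_, fun x => ?_, fun x => ⟨?_, ?_⟩⟩
  · refine contDiff_one_iff_deriv.2 ⟨fun x => (hder x).differentiableAt, ?_⟩
    rw [funext fun x => (hder x).deriv]
    exact (hα.inv₀ fun x => (hpos x).ne').mul (continuous_const.sub hhc)
  · rw [(hder x).deriv, mul_inv_cancel_left₀ (hpos x).ne']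
    change lam - h (w x) x + h (w x) x = lam
    ring
  · rw [← hrel₁]
    change _ ≤ w x
    rw [hfix]
    exact hrmono hv₁.continuous.measurable hmeasw hR₁ hwR hw₁ x
  · rw [← hrel₂]
    change w x ≤ _
    rw [hfix]
    exact hrmono hmeasw hv₂.continuous.measurable hwR hR₂ hw₂ x

end MonotoneScheme

section Measurability

variable {Ω : Type} [MeasurableSpace Ω]

lemma measurable_expWeight {α : ℝ → Ω → ℝ} (hα : Measurable fun q : ℝ × Ω => α q.1 q.2)
    (K : ℝ) : Measurable fun q : Ω × ℝ => expWeight (fun s => α s q.1) K q.2 := by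
  have heq : ∀ q : Ω × ℝ, expWeight (fun s => α s q.1) K q.2 =
      Real.exp (K * (q.2 * ∫ t in Ioc (0 : ℝ) 1, (α (q.2 * t) q.1)⁻¹)) := fun q => by
    rw [expWeight, ← intervalIntegral.integral_of_le zero_le_one,
      intervalIntegral.mul_integral_comp_mul_left (f := fun s => (α s q.1)⁻¹), mul_zero, mul_one]
  simp only [heq]
  have hm : Measurable fun r : (Ω × ℝ) × ℝ => (α (r.1.2 * r.2) r.1.1)⁻¹ :=
    (hα.comp (f := fun r : (Ω × ℝ) × ℝ => (r.1.2 * r.2, r.1.1)) (by fun_prop)).inv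
  have hint := (hm.stronglyMeasurable.integral_prod_right'
    (ν := volume.restrict (Ioc (0 : ℝ) 1))).measurable
  exact Real.measurable_exp.comp ((measurable_snd.mul hint).const_mul K)

lemma measurable_relax_zero {α : ℝ → Ω → ℝ} (hα : Measurable fun q : ℝ × Ω => α q.1 q.2)
    (K : ℝ) {h : ℝ → Ω → ℝ} (hh : Measurable fun q : ℝ × Ω => h q.1 q.2) :
    Measurable fun ω => relax (fun s => α s ω) K (fun y => h y ω) 0 := by
  have hE := measurable_expWeight hα K
  have hm : Measurable fun q : Ω × ℝ =>
      expWeight (fun s => α s q.1) K q.2 * (α q.2 q.1)⁻¹ * h q.2 q.1 :=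
    (hE.mul (hα.comp measurable_swap).inv).mul (hh.comp measurable_swap)
  have hint := (hm.stronglyMeasurable.integral_prod_right'
    (ν := volume.restrict (Iic (0 : ℝ)))).measurable
  exact (hE.comp (f := fun ω => (ω, (0 : ℝ))) (by fun_prop)).inv.mul hint

lemma measurableSet_forall_le {g h : ℝ → Ω → ℝ} (hg : ∀ ω, Continuous fun x => g x ω)
    (hh : ∀ ω, Continuous fun x => h x ω) (hgm : ∀ x, Measurable (g x))
    (hhm : ∀ x, Measurable (h x)) : MeasurableSet {ω | ∀ x, g x ω ≤ h x ω} := by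
  have heq : {ω | ∀ x, g x ω ≤ h x ω} = ⋂ q : ℚ, {ω | g q ω ≤ h q ω} := by
    ext ω
    rw [mem_iInter]
    refine ⟨fun H q => H q, fun H x => ?_⟩
    exact Rat.denseRange_cast.induction_on (p := fun x : ℝ => g x ω ≤ h x ω) x
      (isClosed_le (hg ω) (hh ω)) H
  rw [heq]
  exact MeasurableSet.iInter fun q => measurableSet_le (hgm q) (hhm q)

end Measurability

/-- A strict differential inequality at contact points propagates the order forward. -/
lemma solution_le_of_le {α : ℝ → ℝ} (hpos : ∀ x, 0 < α x) {h : ℝ → ℝ → ℝ} {v₁ v₂ : ℝ → ℝ}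
    {lam₁ lam₂ : ℝ} (hlam : lam₁ < lam₂) (hv₁ : Differentiable ℝ v₁) (hv₂ : Differentiable ℝ v₂)
    (hode₁ : ∀ x, α x * deriv v₁ x + h (v₁ x) x = lam₁)
    (hode₂ : ∀ x, α x * deriv v₂ x + h (v₂ x) x = lam₂) {x₀ x : ℝ} (h0 : v₁ x₀ ≤ v₂ x₀)
    (hx : x₀ ≤ x) : v₁ x ≤ v₂ x := by
  refine image_le_of_deriv_right_lt_deriv_boundary (a := x₀) (b := x) hv₁.continuous.continuousOn
    (fun y _ => (hv₁ y).hasDerivAt.hasDerivWithinAt) h0 (fun y => (hv₂ y).hasDerivAt)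
    (fun y _ hy => ?_) ⟨hx, le_rfl⟩
  have h1 := hode₁ y
  have h2 := hode₂ y
  rw [hy] at h1
  exact lt_of_mul_lt_mul_left (by linarith : α y * deriv v₁ y < α y * deriv v₂ y) (hpos y).le

section Setting

variable {Ω : Type} [MeasurableSpace Ω] {P : Measure Ω} {τ : ℝ → Ω → Ω}
  {a : ℝ → Ω → ℝ} {H : ℝ → ℝ → Ω → ℝ} {G_L G_U : ℝ → ℝ}

namespace HJSetting

lemma a_shift (hset : HJSetting P τ a H G_L G_U)
    (x y : ℝ) (ω : Ω) : a x (τ y ω) = a (x + y) ω := by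
  rw [hset.a_stat x, hset.a_stat (x + y), hset.tau_add]

lemma H_shift (hset : HJSetting P τ a H G_L G_U)
    (p x y : ℝ) (ω : Ω) : H p x (τ y ω) = H p (x + y) ω := by
  rw [hset.H_stat p x, hset.H_stat p (x + y), hset.tau_add]

lemma continuous_a (hset : HJSetting P τ a H G_L G_U) (ω : Ω) : Continuous fun x => a x ω := by
  obtain ⟨κ, -, hκ⟩ := hset.a_sqrt_lip
  have hs : Continuous fun x => Real.sqrt (a x ω) := by
    refine (LipschitzWith.of_dist_le_mul (K := κ.toNNReal) fun x y => ?_).continuous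
    have h := hκ (x - y) (τ y ω)
    rw [hset.a_shift, hset.a_shift, sub_add_cancel, zero_add] at h
    rw [Real.dist_eq, Real.dist_eq]
    exact h.trans (mul_le_mul_of_nonneg_right (Real.le_coe_toNNReal κ) (abs_nonneg _))
  have heq : (fun x => a x ω) = fun x => Real.sqrt (a x ω) ^ 2 :=
    funext fun x => (Real.sq_sqrt (hset.a_pos x ω).le).symm
  rw [heq]
  exact hs.pow 2

lemma H_lip_all (hset : HJSetting P τ a H G_L G_U)
    {R : ℝ} (hR : 0 < R) : ∃ K > (0 : ℝ), ∀ ω p q x, |p| ≤ R → |q| ≤ R →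
    |H p x ω - H q x ω| ≤ K * |p - q| := by
  obtain ⟨K, hK, hlip⟩ := hset.H_lip R hR
  refine ⟨K, hK, fun ω p q x hp hq => ?_⟩
  rw [hset.H_stat p x, hset.H_stat q x]
  exact hlip p q _ hp hq

lemma H_bound (hset : HJSetting P τ a H G_L G_U) {R K : ℝ} (hR : 0 < R)
    (hlip : ∀ ω p q x, |p| ≤ R → |q| ≤ R → |H p x ω - H q x ω| ≤ K * |p - q|) (hK : 0 < K) :
    ∃ C, ∀ ω p x, |p| ≤ R → |H p x ω| ≤ C := by
  refine ⟨K * R + (|G_L 0| + |G_U 0|), fun ω p x hp => ?_⟩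
  have h1 := hlip ω p 0 x hp (by simpa using hR.le)
  rw [sub_zero] at h1
  have h2 : |H 0 x ω| ≤ |G_L 0| + |G_U 0| := by
    rw [hset.H_stat]
    have hl := hset.H_lower 0 (τ x ω)
    have hu := hset.H_upper 0 (τ x ω)
    refine abs_le.2 ⟨?_, ?_⟩
    · linarith [neg_abs_le (G_L 0), abs_nonneg (G_U 0)]
    · linarith [le_abs_self (G_U 0), abs_nonneg (G_L 0)]
  calc |H p x ω| = |(H p x ω - H 0 x ω) + H 0 x ω| := by rw [sub_add_cancel]
    _ ≤ |H p x ω - H 0 x ω| + |H 0 x ω| := abs_add_le _ _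
    _ ≤ _ := add_le_add (h1.trans (mul_le_mul_of_nonneg_left hp hK.le)) h2

lemma continuous_H_comp (hset : HJSetting P τ a H G_L G_U)
    {R : ℝ} (hR : 0 < R) (ω : Ω) {w : ℝ → ℝ} (hw : Continuous w)
    (hwR : ∀ x, |w x| ≤ R) : Continuous fun x => H (w x) x ω := by
  obtain ⟨K, hK, hlip⟩ := hset.H_lip_all hR
  obtain ⟨m, -, -, hm0, hm⟩ := hset.H_mod R hR
  refine continuous_iff_continuousAt.2 fun x₀ => ?_
  rw [continuousAt_iff_punctured_nhds, tendsto_iff_norm_sub_tendsto_zero]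
  have habs : Tendsto (fun x => |x - x₀|) (nhdsWithin x₀ {x₀}ᶜ) (nhdsWithin 0 (Ioi 0)) := by
    refine tendsto_nhdsWithin_iff.2 ⟨?_, ?_⟩
    · have : Continuous fun x : ℝ => |x - x₀| := by fun_prop
      simpa using (this.tendsto x₀).mono_left nhdsWithin_le_nhds
    · filter_upwards [self_mem_nhdsWithin] with x hx
      exact abs_pos.2 (sub_ne_zero.2 hx)
  have hlim : Tendsto (fun x => K * |w x - w x₀| + m |x - x₀|) (nhdsWithin x₀ {x₀}ᶜ)
      (nhds 0) := by
    have h1 : Continuous fun x => K * |w x - w x₀| := by fun_prop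
    have h2 := ((h1.tendsto x₀).mono_left nhdsWithin_le_nhds).add (hm0.comp habs)
    simpa using h2
  refine squeeze_zero (fun _ => norm_nonneg _) (fun x => ?_) hlim
  have h1 := hlip ω (w x) (w x₀) x (hwR x) (hwR x₀)
  have h2 := hm (w x₀) (x - x₀) (τ x₀ ω) (hwR x₀)
  rw [hset.H_shift, hset.H_shift, sub_add_cancel, zero_add] at h2
  calc ‖H (w x) x ω - H (w x₀) x₀ ω‖
      = |(H (w x) x ω - H (w x₀) x ω) + (H (w x₀) x ω - H (w x₀) x₀ ω)| := by
        rw [Real.norm_eq_abs]; congr 1; ring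
    _ ≤ _ := (abs_add_le _ _).trans (add_le_add h1 h2)

lemma eq_preimage_of_imp (hset : HJSetting P τ a H G_L G_U)
    {Q : Ω → Prop} (h : ∀ x ω, Q ω → Q (τ x ω)) (x : ℝ) :
    τ x ⁻¹' {ω | Q ω} = {ω | Q ω} := by
  ext ω
  refine ⟨fun hω => ?_, fun hω => h x ω hω⟩
  have := h (-x) _ hω
  rwa [← hset.tau_add, neg_add_cancel, hset.tau_zero] at this

/-- An almost sure property of the orbits holds on a measurable, strictly invariant set of full
measure. -/
lemma exists_invariant_core (hset : HJSetting P τ a H G_L G_U) {Q : Ω → Prop} (hQ : ∀ᵐ ω ∂P, Q ω)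
    (hinv : ∀ x ω, Q (τ x ω) → Q ω) :
    ∃ G : Set Ω, MeasurableSet G ∧ (∀ x ω, τ x ω ∈ G ↔ ω ∈ G) ∧ (∀ᵐ ω ∂P, ω ∈ G) ∧
      ∀ ω ∈ G, Q ω := by
  have := hset.prob
  obtain ⟨N, hQN, hNm, hN⟩ := exists_measurable_superset_of_null (ae_iff.1 hQ)
  have hS : MeasurableSet {q : Ω × ℝ | τ q.2 q.1 ∈ N} :=
    (hset.meas_tau.comp measurable_swap) hNm
  have hsec : Measurable fun ω => volume {x | τ x ω ∈ N} := measurable_measure_prodMk_left hS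
  refine ⟨{ω | volume {x | τ x ω ∈ N} = 0}, hsec (measurableSet_singleton 0), fun x ω => ?_, ?_,
    fun ω hω => ?_⟩
  · have heq : {y | τ y (τ x ω) ∈ N} = (fun y => y + x) ⁻¹' {y | τ y ω ∈ N} := by
      ext y
      change τ y (τ x ω) ∈ N ↔ τ (y + x) ω ∈ N
      rw [hset.tau_add]
    change volume {y | τ y (τ x ω) ∈ N} = 0 ↔ _
    rw [heq, measure_preimage_add_right]
    rfl
  · refine Measure.measure_ae_null_of_prod_null (s := {q : Ω × ℝ | τ q.2 q.1 ∈ N}) ?_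
    rw [Measure.prod_apply_symm hS]
    have hz : ∀ y, P ((fun x => (x, y)) ⁻¹' {q : Ω × ℝ | τ q.2 q.1 ∈ N}) = 0 := fun y =>
      ((hset.mp_tau y).measure_preimage hNm.nullMeasurableSet).trans hN
    simp only [hz, lintegral_zero]
  · by_contra hQω
    have huniv : {x | τ x ω ∈ N} = univ := by
      refine eq_univ_of_forall fun x => hQN ?_
      exact fun h => hQω (hinv x ω h)
    have h0 : volume {x | τ x ω ∈ N} = 0 := hω
    rw [huniv] at h0
    simp at h0

end HJSetting

namespace StatSol

variable {lam lam₁ lam₂ : ℝ} {f f₁ f₂ : ℝ → Ω → ℝ}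

lemma measurable_apply (hf : StatSol P τ a H lam f) (x : ℝ) : Measurable (f x) :=
  hf.1.comp (f := fun ω => (x, ω)) (by fun_prop)

lemma continuous (hf : StatSol P τ a H lam f) (ω : Ω) : Continuous fun x => f x ω :=
  (hf.2.2.1 ω).continuous

lemma differentiable (hf : StatSol P τ a H lam f) (ω : Ω) : Differentiable ℝ fun x => f x ω :=
  (hf.2.2.1 ω).differentiable one_ne_zero

lemma shift (hset : HJSetting P τ a H G_L G_U) (hf : StatSol P τ a H lam f) (x y : ℝ) (ω : Ω) :
    f x (τ y ω) = f (x + y) ω := by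
  rw [hf.2.1 x, hf.2.1 (x + y), hset.tau_add]

lemma exists_ae_bound (hset : HJSetting P τ a H G_L G_U) (hf : StatSol P τ a H lam f) :
    ∃ M, ∀ᵐ ω ∂P, ∀ x, |f x ω| ≤ M := by
  have := hset.prob
  by_contra hno
  have hnull : ∀ n : ℕ, P {ω | ∀ x, |f x ω| ≤ n} = 0 := fun n => by
    have hm : MeasurableSet {ω | ∀ x, |f x ω| ≤ n} :=
      measurableSet_forall_le (fun ω => (hf.continuous ω).abs) (fun _ => continuous_const)
        (fun x => (hf.measurable_apply x).abs) fun _ => measurable_const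
    refine (hset.ergodic _ hm (hset.eq_preimage_of_imp fun x ω h y => ?_)).resolve_right
      fun h1 => ?_
    · rw [hf.shift hset]
      exact h _
    · exact hno ⟨n, (mem_ae_iff_prob_eq_one hm).2 h1⟩
  have hall := ae_all_iff.2 fun n => measure_eq_zero_iff_ae_notMem.1 (hnull n)
  obtain ⟨ω, hω, ⟨M, hM⟩, -⟩ := (hall.and hf.2.2.2).exists
  obtain ⟨n, hn⟩ := exists_nat_ge M
  exact hω n fun x => (hM x).trans hn

lemma integrable (hset : HJSetting P τ a H G_L G_U) (hf : StatSol P τ a H lam f) :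
    Integrable (f 0) P := by
  have := hset.prob
  obtain ⟨M, hM⟩ := hf.exists_ae_bound hset
  exact Integrable.of_bound (hf.measurable_apply 0).aestronglyMeasurable M
    (hM.mono fun ω h => h 0)

/-- For increasing values, the order of the means forces the order of the solutions. -/
lemma ae_le (hset : HJSetting P τ a H G_L G_U) (hf₁ : StatSol P τ a H lam₁ f₁)
    (hf₂ : StatSol P τ a H lam₂ f₂) (hlam : lam₁ < lam₂)
    (hmean : ∫ ω, f₁ 0 ω ∂P < ∫ ω, f₂ 0 ω ∂P) : ∀ᵐ ω ∂P, ∀ x, f₁ x ω ≤ f₂ x ω := by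
  have := hset.prob
  have hnull : P {ω | ∀ x, f₂ x ω ≤ f₁ x ω} = 0 := by
    have hm : MeasurableSet {ω | ∀ x, f₂ x ω ≤ f₁ x ω} := measurableSet_forall_le
      hf₂.continuous hf₁.continuous hf₂.measurable_apply hf₁.measurable_apply
    refine (hset.ergodic _ hm (hset.eq_preimage_of_imp fun x ω h y => ?_)).resolve_right fun h1 => ?_
    · rw [hf₁.shift hset, hf₂.shift hset]
      exact h _
    · have hae : ∀ᵐ ω ∂P, ∀ x, f₂ x ω ≤ f₁ x ω := (mem_ae_iff_prob_eq_one hm).2 h1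
      exact hmean.not_ge (integral_mono_ae (hf₂.integrable hset) (hf₁.integrable hset)
        (hae.mono fun ω h => h 0))
  have hN : ∀ x, MeasurableSet {ω | f₂ x ω < f₁ x ω} := fun x =>
    measurableSet_lt (hf₂.measurable_apply x) (hf₁.measurable_apply x)
  have hconst : ∀ x, P {ω | f₂ x ω < f₁ x ω} = P {ω | f₂ 0 ω < f₁ 0 ω} := fun x => by
    rw [← (hset.mp_tau x).measure_preimage (hN 0).nullMeasurableSet]
    congr 1
    ext ω
    change _ ↔ f₂ 0 (τ x ω) < f₁ 0 (τ x ω)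
    rw [← hf₁.2.1, ← hf₂.2.1]
    rfl
  have hlim : Tendsto (fun n : ℕ => P {ω | f₂ n ω < f₁ n ω}) atTop (nhds (P ∅)) := by
    refine tendsto_measure_of_ae_tendsto_indicator_of_isFiniteMeasure atTop MeasurableSet.empty
      (fun n => hN n) ?_
    filter_upwards [measure_eq_zero_iff_ae_notMem.1 hnull, hf₁.2.2.2, hf₂.2.2.2] with ω h0 h1 h2
    have hex : ∃ x, f₁ x ω < f₂ x ω := by
      by_contra! hcon
      exact h0 hcon
    obtain ⟨x₀, hx₀⟩ := hex
    filter_upwards [(tendsto_natCast_atTop_atTop (R := ℝ)).eventually_ge_atTop x₀] with n hn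
    refine ⟨fun hlt => ?_, fun h => h.elim⟩
    exact (not_le.2 hlt (solution_le_of_le (h := fun p x => H p x ω)
      (fun x => hset.a_pos x ω) hlam (hf₁.differentiable ω) (hf₂.differentiable ω) h1.2 h2.2
      hx₀.le hn)).elim
  simp only [hconst, measure_empty] at hlim
  have hzero := tendsto_nhds_unique tendsto_const_nhds hlim
  have hrat : ∀ᵐ ω ∂P, ∀ q : ℚ, ¬ f₂ q ω < f₁ q ω :=
    ae_all_iff.2 fun q => measure_eq_zero_iff_ae_notMem.1 ((hconst q).trans hzero)
  filter_upwards [hrat] with ω h x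
  exact Rat.denseRange_cast.induction_on (p := fun x : ℝ => f₁ x ω ≤ f₂ x ω) x
    (isClosed_le (hf₁.continuous ω) (hf₂.continuous ω)) fun q => not_lt.1 (h q)

end StatSol
namespace HJSetting

/-- Two solutions with increasing values and increasing means admit a stationary solution whose
mean lies strictly in between. -/
lemma exists_mem_Eset_between (hset : HJSetting P τ a H G_L G_U) {lam₁ lam₂ : ℝ}
    {f₁ f₂ : ℝ → Ω → ℝ} (hf₁ : StatSol P τ a H lam₁ f₁) (hf₂ : StatSol P τ a H lam₂ f₂)
    (hlam : lam₁ < lam₂) (hmean : ∫ ω, f₁ 0 ω ∂P < ∫ ω, f₂ 0 ω ∂P) :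
    ∃ θ ∈ Eset P τ a H, ∫ ω, f₁ 0 ω ∂P < θ ∧ θ < ∫ ω, f₂ 0 ω ∂P := by
  have := hset.prob
  obtain ⟨M₁, hM₁⟩ := hf₁.exists_ae_bound hset
  obtain ⟨M₂, hM₂⟩ := hf₂.exists_ae_bound hset
  obtain ⟨R, hR, hR₁, hR₂⟩ : ∃ R > 0, M₁ ≤ R ∧ M₂ ≤ R :=
    ⟨max 1 (max M₁ M₂), by positivity, (le_max_left _ _).trans (le_max_right _ _),
      (le_max_right _ _).trans (le_max_right _ _)⟩
  obtain ⟨K, hK, hlip⟩ := hset.H_lip_all hR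
  obtain ⟨C, hC⟩ := hset.H_bound hR hlip hK
  obtain ⟨lam, hl₁, hl₂⟩ := exists_between hlam
  obtain ⟨G, hGm, hGinv, hGae, hG⟩ := hset.exists_invariant_core
    (Q := fun ω => (∀ x, |f₁ x ω| ≤ R) ∧ (∀ x, |f₂ x ω| ≤ R) ∧ (∀ x, f₁ x ω ≤ f₂ x ω) ∧
      (∀ x, a x ω * deriv (fun y => f₁ y ω) x + H (f₁ x ω) x ω = lam₁) ∧
      ∀ x, a x ω * deriv (fun y => f₂ y ω) x + H (f₂ x ω) x ω = lam₂)
    (by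
      filter_upwards [hM₁, hM₂, hf₁.ae_le hset hf₂ hlam hmean, hf₁.2.2.2, hf₂.2.2.2]
        with ω h1 h2 h3 h4 h5
      exact ⟨fun x => (h1 x).trans hR₁, fun x => (h2 x).trans hR₂, h3, h4.2, h5.2⟩)
    (fun x ω hω => by
      simp only [hf₁.shift hset, hf₂.shift hset, hset.a_shift, hset.H_shift] at hω
      obtain ⟨h1, h2, h3, h4, h5⟩ := hω
      refine ⟨fun y => ?_, fun y => ?_, fun y => ?_, fun y => ?_, fun y => ?_⟩
      · simpa using h1 (y - x)
      · simpa using h2 (y - x)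
      · simpa using h3 (y - x)
      · simpa [deriv_comp_add_const (fun y => f₁ y ω)] using h4 (y - x)
      · simpa [deriv_comp_add_const (fun y => f₂ y ω)] using h5 (y - x))
  let F : ℕ → Ω → ℝ := fun k => Nat.rec (f₂ 0) (fun _ g ω =>
    relax (fun s => a s ω) K (fun y => lam + K * g (τ y ω) - H (g (τ y ω)) 0 (τ y ω)) 0) k
  have hFsucc : ∀ k ω, F (k + 1) ω = relax (fun s => a s ω) K
      (fun y => lam + K * F k (τ y ω) - H (F k (τ y ω)) 0 (τ y ω)) 0 := fun k ω => rfl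
  have hFm : ∀ k, Measurable (F k) := by
    intro k
    induction k with
    | zero => exact hf₂.measurable_apply 0
    | succ k ih =>
      refine measurable_relax_zero (h := fun y ω =>
        lam + K * F k (τ y ω) - H (F k (τ y ω)) 0 (τ y ω)) hset.meas_a K ?_
      have h1 : Measurable fun q : ℝ × Ω => F k (τ q.1 q.2) := ih.comp hset.meas_tau
      exact ((h1.const_mul K).const_add lam).sub
        (hset.meas_H.comp (h1.prodMk (measurable_const.prodMk hset.meas_tau)))
  let f : ℝ → Ω → ℝ := fun x ω => G.indicator (fun ω => ⨅ k, F k ω) (τ x ω)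
  have hf_of_mem : ∀ ω ∈ G, (fun x => f x ω) = fun x => ⨅ k, F k (τ x ω) := fun ω hω =>
    funext fun x => indicator_of_mem ((hGinv x ω).2 hω) _
  have hf_of_notMem : ∀ ω ∉ G, (fun x => f x ω) = fun _ => 0 := fun ω hω =>
    funext fun x => indicator_of_notMem (fun h => hω ((hGinv x ω).1 h)) _
  have hsol : ∀ ω ∈ G, ContDiff ℝ 1 (fun x => f x ω) ∧
      (∀ x, a x ω * deriv (fun x => f x ω) x + H (f x ω) x ω = lam) ∧
      ∀ x, f₁ x ω + (lam - lam₁) / K ≤ f x ω ∧ f x ω ≤ f₂ x ω + (lam - lam₂) / K := by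
    intro ω hω
    obtain ⟨h1, h2, h3, h4, h5⟩ := hG ω hω
    have key := solution_of_iterate (α := fun x => a x ω) (h := fun p x => H p x ω)
      (u := fun k x => F k (τ x ω)) (hset.continuous_a ω) (fun x => hset.a_pos x ω)
      (fun x => hset.a_le_one x ω) hK
      (hset.meas_H.comp (f := fun q : ℝ × ℝ => (q.1, q.2, ω)) (by fun_prop))
      (fun p q x => hlip ω p q x) (fun p x => hC ω p x)
      (fun w hw hwR => hset.continuous_H_comp hR ω hw hwR) (hf₁.differentiable ω)
      (hf₂.differentiable ω) h4 h5 h1 h2 h3 hl₁.le hl₂.le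
      (fun k => (hFm k).comp (hset.meas_tau.comp (f := fun x => (x, ω)) (by fun_prop)))
      (fun x => (hf₂.2.1 x ω).symm) (fun k x => by
        rw [hFsucc]
        simp only [hset.a_shift, ← hset.tau_add, ← hset.H_stat]
        exact relax_shift (hset.continuous_a ω) (fun x => hset.a_pos x ω)
          (fun y => lam + K * F k (τ y ω) - H (F k (τ y ω)) y ω) x)
    have hx : ∀ x, f x ω = ⨅ k, F k (τ x ω) := fun x => congrFun (hf_of_mem ω hω) x
    rw [hf_of_mem ω hω]
    simp only [hx]
    exact key
  have hstat : StatSol P τ a H lam f := by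
    refine ⟨((Measurable.iInf hFm).indicator hGm).comp hset.meas_tau, fun x ω => ?_, fun ω => ?_,
      ?_⟩
    · change _ = G.indicator _ (τ 0 (τ x ω))
      rw [hset.tau_zero]
    · by_cases hω : ω ∈ G
      · exact (hsol ω hω).1
      · rw [hf_of_notMem ω hω]
        exact contDiff_const
    · filter_upwards [hGae] with ω hω
      obtain ⟨h1, h2, -⟩ := hG ω hω
      obtain ⟨-, hode, hbd⟩ := hsol ω hω
      refine ⟨⟨R, fun x => abs_le.2 ⟨?_, ?_⟩⟩, hode⟩
      · have := div_pos (sub_pos.2 hl₁) hK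
        linarith [(abs_le.1 (h1 x)).1, (hbd x).1]
      · have := div_neg_of_neg_of_pos (sub_neg.2 hl₂) hK
        linarith [(abs_le.1 (h2 x)).2, (hbd x).2]
  refine ⟨_, ⟨lam, f, hstat, rfl⟩, ?_, ?_⟩
  · have h := integral_mono_ae ((hf₁.integrable hset).add (integrable_const ((lam - lam₁) / K)))
      (hstat.integrable hset) (hGae.mono fun ω hω => ((hsol ω hω).2.2 0).1)
    simp only [Pi.add_apply] at h
    rw [integral_add (hf₁.integrable hset) (integrable_const _), integral_const,
      probReal_univ, one_smul] at h
    linarith [div_pos (sub_pos.2 hl₁) hK]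
  · have h := integral_mono_ae (hstat.integrable hset)
      ((hf₂.integrable hset).add (integrable_const ((lam - lam₂) / K)))
      (hGae.mono fun ω hω => ((hsol ω hω).2.2 0).2)
    simp only [Pi.add_apply] at h
    rw [integral_add (hf₂.integrable hset) (integrable_const _), integral_const,
      probReal_univ, one_smul] at h
    linarith [div_neg_of_neg_of_pos (sub_neg.2 hl₂) hK]

/-- Reflecting both space and momentum preserves the setting. -/
lemma reflect (hset : HJSetting P τ a H G_L G_U) :
    HJSetting P (fun x => τ (-x)) (fun x => a (-x)) (fun p x => H (-p) (-x)) G_L G_U where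
  prob := hset.prob
  meas_tau := hset.meas_tau.comp (f := fun q : ℝ × Ω => (-q.1, q.2)) (by fun_prop)
  mp_tau x := hset.mp_tau (-x)
  tau_zero ω := by simp [hset.tau_zero]
  tau_add x y ω := by rw [neg_add, hset.tau_add]
  ergodic A hA h := hset.ergodic A hA fun x => by simpa using h (-x)
  meas_a := hset.meas_a.comp (f := fun q : ℝ × Ω => (-q.1, q.2)) (by fun_prop)
  a_pos x := hset.a_pos (-x)
  a_le_one x := hset.a_le_one (-x)
  a_stat x ω := by rw [neg_zero, hset.a_stat]
  a_sqrt_lip := by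
    obtain ⟨κ, hκ, h⟩ := hset.a_sqrt_lip
    exact ⟨κ, hκ, fun x ω => by simpa using h (-x) ω⟩
  meas_H := hset.meas_H.comp (f := fun q : ℝ × ℝ × Ω => (-q.1, -q.2.1, q.2.2)) (by fun_prop)
  H_stat p x ω := by rw [neg_zero, hset.H_stat]
  GL_cont := hset.GL_cont
  GU_cont := hset.GU_cont
  GL_even := hset.GL_even
  GU_even := hset.GU_even
  GL_mono := hset.GL_mono
  GU_mono := hset.GU_mono
  GL_coercive := hset.GL_coercive
  GU_coercive := hset.GU_coercive
  H_lower p ω := by rw [neg_zero, ← hset.GL_even]; exact hset.H_lower _ _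
  H_upper p ω := by rw [neg_zero, ← hset.GU_even p]; exact hset.H_upper _ _
  H_lip R hR := by
    obtain ⟨K, hK, h⟩ := hset.H_lip R hR
    refine ⟨K, hK, fun p q ω hp hq => ?_⟩
    have := h (-p) (-q) ω (by rwa [abs_neg]) (by rwa [abs_neg])
    rwa [neg_sub_neg, abs_sub_comm q p, ← neg_zero] at this
  H_mod R hR := by
    obtain ⟨m, h0, h1, h2, h⟩ := hset.H_mod R hR
    refine ⟨m, h0, h1, h2, fun p x ω hp => ?_⟩
    simpa using h (-p) (-x) ω (by rwa [abs_neg])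

end HJSetting

lemma StatSol.reflect {lam : ℝ} {f : ℝ → Ω → ℝ} (hf : StatSol P τ a H lam f) :
    StatSol P (fun x => τ (-x)) (fun x => a (-x)) (fun p x => H (-p) (-x)) lam
      (fun x ω => -f (-x) ω) := by
  refine ⟨(hf.1.comp (f := fun q : ℝ × Ω => (-q.1, q.2)) (by fun_prop)).neg, fun x ω => ?_,
    fun ω => ((hf.2.2.1 ω).comp contDiff_neg).neg, ?_⟩
  · simp only [neg_zero]
    rw [hf.2.1]
  · filter_upwards [hf.2.2.2] with ω hω
    obtain ⟨⟨M, hM⟩, hode⟩ := hω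
    refine ⟨⟨M, fun x => by rw [abs_neg]; exact hM (-x)⟩, fun x => ?_⟩
    have hd : deriv (fun y => -f (-y) ω) x = deriv (fun y => f y ω) (-x) := by
      rw [deriv.fun_neg, deriv_comp_neg (fun y => f y ω), neg_neg]
    rw [hd, neg_neg]
    exact hode (-x)

lemma neg_mem_Eset_of_mem_reflect {θ : ℝ}
    (hθ : θ ∈ Eset P (fun x => τ (-x)) (fun x => a (-x)) (fun p x => H (-p) (-x))) :
    -θ ∈ Eset P τ a H := by
  obtain ⟨lam, f, hf, rfl⟩ := hθ
  refine ⟨lam, _, by simpa using hf.reflect, ?_⟩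
  simp [integral_neg]

end Setting

theorem lambda_equal_at_gap_endpoints
    {Ω : Type} [MeasurableSpace Ω] (P : Measure Ω) (τ : ℝ → Ω → Ω)
    (a : ℝ → Ω → ℝ) (H : ℝ → ℝ → Ω → ℝ) (G_L G_U : ℝ → ℝ)
    (hset : HJSetting P τ a H G_L G_U)
    (θ₁ θ₂ : ℝ) (hθ : θ₁ < θ₂)
    (hθ₁ : θ₁ ∈ Eset P τ a H) (hθ₂ : θ₂ ∈ Eset P τ a H)
    (hgap : Ioo θ₁ θ₂ ∩ Eset P τ a H = ∅)
    (lam₁ lam₂ : ℝ) (f₁ f₂ : ℝ → Ω → ℝ)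
    (hf₁ : StatSol P τ a H lam₁ f₁) (hf₂ : StatSol P τ a H lam₂ f₂)
    (hmean₁ : (∫ ω, f₁ 0 ω ∂P) = θ₁) (hmean₂ : (∫ ω, f₂ 0 ω ∂P) = θ₂) :
    lam₁ = lam₂ := by
  rcases lt_trichotomy lam₁ lam₂ with hlt | heq | hgt
  · obtain ⟨θ, hθE, h1, h2⟩ := hset.exists_mem_Eset_between hf₁ hf₂ hlt (by rwa [hmean₁, hmean₂])
    rw [hmean₁] at h1
    rw [hmean₂] at h2
    exact (hgap.subset ⟨⟨h1, h2⟩, hθE⟩).elim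
  · exact heq
  · obtain ⟨θ, hθE, h1, h2⟩ := hset.reflect.exists_mem_Eset_between hf₂.reflect hf₁.reflect hgt
      (by simpa [integral_neg, hmean₁, hmean₂] using hθ)
    simp only [neg_zero, integral_neg, hmean₁, hmean₂] at h1 h2
    exact (hgap.subset ⟨⟨by linarith, by linarith⟩, neg_mem_Eset_of_mem_reflect hθE⟩).elim
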